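/- Let (H,δ) be a Fredholm chain of Hilbert spaces H_p and bounded operators δ_p ∈ L(H_p,H_{p−1}), p ∈ ℤ, with H_p = 0 and δ_p = 0 for p < 0 and p ≥ n+1. Let k_p ∈ K(H_p,H_{p−1}) be compact operators and set δ′_p = δ_p + k_p for each p ∈ ℤ. Suppose that R(δ′_pδ′_{p+1}) is finite-dimensional for each p ∈ ℤ. Then (H,δ′) is a Fredholm chain and ind(H,δ) = ind(H,δ′). -/

import Mathlib

open Module ContinuousLinearMap

noncomputable section

set_option maxHeartbeats 1000000
set_option synthInstance.maxHeartbeats 1000000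

/-- For submodules `p q` of a space `E`, the quotient space `p / (p ⊓ q)`. -/
abbrev relQuot {E : Type*} [AddCommGroup E] [Module ℂ E] (p q : Submodule ℂ E) : Type _ :=
  ↥p ⧸ ((p ⊓ q).comap p.subtype)

section Defs

variable {H₁ H₂ : Type*} [NormedAddCommGroup H₁] [NormedSpace ℂ H₁]
  [NormedAddCommGroup H₂] [NormedSpace ℂ H₂]

/-- `(S, T)` is a Fredholm pair if the four quotients `N(S)/(N(S) ⊓ R(T))`,
`R(T)/(N(S) ⊓ R(T))`, `N(T)/(N(T) ⊓ R(S))`, `R(S)/(N(T) ⊓ R(S))` are finite dimensional. -/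
def IsFredholmPair (S : H₁ →L[ℂ] H₂) (T : H₂ →L[ℂ] H₁) : Prop :=
  FiniteDimensional ℂ (relQuot (LinearMap.ker S.toLinearMap) (LinearMap.range T.toLinearMap)) ∧
  FiniteDimensional ℂ (relQuot (LinearMap.range T.toLinearMap) (LinearMap.ker S.toLinearMap)) ∧
  FiniteDimensional ℂ (relQuot (LinearMap.ker T.toLinearMap) (LinearMap.range S.toLinearMap)) ∧
  FiniteDimensional ℂ (relQuot (LinearMap.range S.toLinearMap) (LinearMap.ker T.toLinearMap))

/-- The index of a Fredholm pair:
`ind (S,T) = dim N(S)/(N(S)⊓R(T)) - dim R(T)/(N(S)⊓R(T)) - dim N(T)/(N(T)⊓R(S)) + dim R(S)/(N(T)⊓R(S))`. -/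
def pairIndex (S : H₁ →L[ℂ] H₂) (T : H₂ →L[ℂ] H₁) : ℤ :=
  (finrank ℂ (relQuot (LinearMap.ker S.toLinearMap) (LinearMap.range T.toLinearMap)) : ℤ)
    - (finrank ℂ (relQuot (LinearMap.range T.toLinearMap) (LinearMap.ker S.toLinearMap)) : ℤ)
    - (finrank ℂ (relQuot (LinearMap.ker T.toLinearMap) (LinearMap.range S.toLinearMap)) : ℤ)
    + (finrank ℂ (relQuot (LinearMap.range S.toLinearMap) (LinearMap.ker T.toLinearMap)) : ℤ)

/-- A bounded operator is Fredholm if its kernel is finite dimensional, its range is closed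
and its cokernel is finite dimensional. -/
def IsFredholmOp (A : H₁ →L[ℂ] H₂) : Prop :=
  FiniteDimensional ℂ (LinearMap.ker A.toLinearMap) ∧ IsClosed (LinearMap.range A.toLinearMap : Set H₂) ∧
  FiniteDimensional ℂ (H₂ ⧸ LinearMap.range A.toLinearMap)

/-- The index of a Fredholm operator: `ind A = dim N(A) - dim H₂/R(A)`. -/
def opIndex (A : H₁ →L[ℂ] H₂) : ℤ :=
  (finrank ℂ (LinearMap.ker A.toLinearMap) : ℤ) - (finrank ℂ (H₂ ⧸ LinearMap.range A.toLinearMap) : ℤ)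

end Defs

section ChainDefs

variable (H : ℤ → Type*) [∀ p, NormedAddCommGroup (H p)] [∀ p, InnerProductSpace ℂ (H p)]

/-- The identification `H p ≃ H q` coming from an equality of indices `p = q`. -/
def fcast {p q : ℤ} (h : p = q) : H p ≃ₗᵢ[ℂ] H q := by
  subst h; exact LinearIsometryEquiv.refl ℂ (H p)

/-- The identification `H p ≃ H q` as a continuous linear map. -/
def fcastL {p q : ℤ} (h : p = q) : H p →L[ℂ] H q :=
  (fcast H h).toLinearIsometry.toContinuousLinearMap

variable (δ : ∀ p : ℤ, H p →L[ℂ] H (p - 1))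

/-- The range of `δ (p+1)` viewed as a subspace of `H p`. -/
def chainRange (p : ℤ) : Submodule ℂ (H p) :=
  Submodule.map (fcastL H (show p + 1 - 1 = p by ring)).toLinearMap (LinearMap.range (δ (p + 1)).toLinearMap)

/-- The composition `δ p ∘ δ (p+1) : H (p+1) → H (p-1)`. -/
def chainComp (p : ℤ) : H (p + 1) →L[ℂ] H (p - 1) :=
  δ p ∘L (fcastL H (show p + 1 - 1 = p by ring) ∘L δ (p + 1))

/-- `(H, δ)` is a Fredholm chain if `N(δ p)/(N(δ p) ⊓ R(δ (p+1)))` and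
`R(δ (p+1))/(N(δ p) ⊓ R(δ (p+1)))` are finite dimensional for every `p ∈ ℤ`. -/
def IsFredholmChain : Prop :=
  ∀ p : ℤ, FiniteDimensional ℂ (relQuot (LinearMap.ker (δ p).toLinearMap) (chainRange H δ p)) ∧
    FiniteDimensional ℂ (relQuot (chainRange H δ p) (LinearMap.ker (δ p).toLinearMap))

/-- The index of a Fredholm chain supported on `0, …, n`:
`ind (H,δ) = ∑ (-1)^p (dim N(δ p)/(N(δ p) ⊓ R(δ (p+1))) - dim R(δ (p+1))/(N(δ p) ⊓ R(δ (p+1))))`. -/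
def chainIndex (n : ℕ) : ℤ :=
  ∑ j ∈ Finset.range (n + 1), (-1 : ℤ) ^ j *
    ((finrank ℂ (relQuot (LinearMap.ker (δ (j : ℤ)).toLinearMap) (chainRange H δ (j : ℤ))) : ℤ)
      - (finrank ℂ (relQuot (chainRange H δ (j : ℤ)) (LinearMap.ker (δ (j : ℤ)).toLinearMap)) : ℤ))

end ChainDefs

section RelQuot

variable {E F : Type*} [AddCommGroup E] [Module ℂ E] [AddCommGroup F] [Module ℂ F]

/-- The map `p / (p ⊓ q) → p' / (p' ⊓ q')` induced by a linear map sending `p` into `p'` and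
`p ⊓ q` into `q'`. -/
def relQuotMap {p q : Submodule ℂ E} {p' q' : Submodule ℂ F} (f : E →ₗ[ℂ] F)
    (hp : ∀ x ∈ p, f x ∈ p') (hq : ∀ x ∈ p, x ∈ q → f x ∈ q') : relQuot p q →ₗ[ℂ] relQuot p' q' :=
  Submodule.mapQ _ _ (f.restrict hp) (by
    rintro ⟨x, hx⟩ h
    simp only [Submodule.mem_comap, Submodule.mem_inf, Submodule.subtype_apply] at h ⊢
    exact ⟨hp x hx, hq x hx h.2⟩)

lemma relQuotMap_mk {p q : Submodule ℂ E} {p' q' : Submodule ℂ F} (f : E →ₗ[ℂ] F)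
    (hp : ∀ x ∈ p, f x ∈ p') (hq : ∀ x ∈ p, x ∈ q → f x ∈ q') (x : p) :
    relQuotMap f hp hq (Submodule.Quotient.mk x) = Submodule.Quotient.mk ⟨f x, hp x x.2⟩ := rfl

lemma relQuot_mk_eq_zero {p q : Submodule ℂ E} (x : p) :
    (Submodule.Quotient.mk x : relQuot p q) = 0 ↔ (x : E) ∈ q := by
  rw [Submodule.Quotient.mk_eq_zero]
  simp

lemma relQuotMap_injective {p q : Submodule ℂ E} {p' q' : Submodule ℂ F} (f : E →ₗ[ℂ] F)
    (hp : ∀ x ∈ p, f x ∈ p') (hq : ∀ x ∈ p, x ∈ q → f x ∈ q')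
    (h : ∀ x ∈ p, f x ∈ q' → x ∈ q) : Function.Injective (relQuotMap f hp hq) := by
  rw [injective_iff_map_eq_zero]
  intro a
  induction a using Submodule.Quotient.induction_on with | _ x
  rw [relQuotMap_mk, relQuot_mk_eq_zero, relQuot_mk_eq_zero]
  exact h x x.2

lemma relQuotMap_surjective {p q : Submodule ℂ E} {p' q' : Submodule ℂ F} (f : E →ₗ[ℂ] F)
    (hp : ∀ x ∈ p, f x ∈ p') (hq : ∀ x ∈ p, x ∈ q → f x ∈ q')
    (h : ∀ y ∈ p', ∃ x ∈ p, f x - y ∈ q') : Function.Surjective (relQuotMap f hp hq) := by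
  intro a
  induction a using Submodule.Quotient.induction_on with | _ y
  obtain ⟨x, hx, hxy⟩ := h y y.2
  refine ⟨Submodule.Quotient.mk ⟨x, hx⟩, ?_⟩
  rw [relQuotMap_mk, ← sub_eq_zero, ← Submodule.Quotient.mk_sub, relQuot_mk_eq_zero]
  exact hxy

lemma relQuotMap_exact {G : Type*} [AddCommGroup G] [Module ℂ G]
    {p q : Submodule ℂ E} {p' q' : Submodule ℂ F} {p'' q'' : Submodule ℂ G}
    (f : E →ₗ[ℂ] F) (hp : ∀ x ∈ p, f x ∈ p') (hq : ∀ x ∈ p, x ∈ q → f x ∈ q')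
    (g : F →ₗ[ℂ] G) (hp' : ∀ x ∈ p', g x ∈ p'') (hq' : ∀ x ∈ p', x ∈ q' → g x ∈ q'')
    (h : ∀ y ∈ p', g y ∈ q'' ↔ ∃ x ∈ p, f x - y ∈ q') :
    Function.Exact (relQuotMap f hp hq) (relQuotMap g hp' hq') := by
  intro a
  induction a using Submodule.Quotient.induction_on with | _ y
  rw [relQuotMap_mk, relQuot_mk_eq_zero, h y y.2]
  constructor
  · rintro ⟨x, hx, hxy⟩
    refine ⟨Submodule.Quotient.mk ⟨x, hx⟩, ?_⟩
    rw [relQuotMap_mk, ← sub_eq_zero, ← Submodule.Quotient.mk_sub, relQuot_mk_eq_zero]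
    exact hxy
  · rintro ⟨b, hb⟩
    induction b using Submodule.Quotient.induction_on with | _ x
    rw [relQuotMap_mk, ← sub_eq_zero, ← Submodule.Quotient.mk_sub, relQuot_mk_eq_zero] at hb
    exact ⟨x, x.2, hb⟩

lemma finiteDimensional_of_exact {X Y Z : Type*} [AddCommGroup X] [Module ℂ X]
    [AddCommGroup Y] [Module ℂ Y] [AddCommGroup Z] [Module ℂ Z] {f : X →ₗ[ℂ] Y} {g : Y →ₗ[ℂ] Z}
    (h : Function.Exact f g) [FiniteDimensional ℂ X] [FiniteDimensional ℂ Z] :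
    FiniteDimensional ℂ Y := by
  have h1 : FiniteDimensional ℂ (LinearMap.ker g) := by
    rw [h.linearMap_ker_eq]; infer_instance
  have h2 : FiniteDimensional ℂ (Y ⧸ LinearMap.ker g) :=
    Module.Finite.of_injective _ (LinearMap.quotKerEquivRange g).injective
  exact Module.Finite.of_submodule_quotient (LinearMap.ker g)

lemma finrank_of_exact {X Y Z : Type*} [AddCommGroup X] [Module ℂ X]
    [AddCommGroup Y] [Module ℂ Y] [AddCommGroup Z] [Module ℂ Z] {f : X →ₗ[ℂ] Y} {g : Y →ₗ[ℂ] Z}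
    (h : Function.Exact f g) (hf : Function.Injective f) (hg : Function.Surjective g)
    [FiniteDimensional ℂ Y] : finrank ℂ Y = finrank ℂ X + finrank ℂ Z := by
  rw [← LinearMap.finrank_range_add_finrank_ker g, h.linearMap_ker_eq,
    LinearMap.finrank_range_of_inj hf, LinearMap.range_eq_top.2 hg, finrank_top, add_comm]

lemma subsingleton_relQuot {p q : Submodule ℂ E} (h : p ≤ q) : Subsingleton (relQuot p q) := by
  refine ⟨fun a b => ?_⟩
  induction a using Submodule.Quotient.induction_on with | _ x
  induction b using Submodule.Quotient.induction_on with | _ y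
  rw [← sub_eq_zero, ← Submodule.Quotient.mk_sub, relQuot_mk_eq_zero]
  exact h (x - y).2

lemma finrank_relQuot_of_le {p q : Submodule ℂ E} (h : p ≤ q) : finrank ℂ (relQuot p q) = 0 :=
  haveI := subsingleton_relQuot h
  finrank_zero_of_subsingleton

lemma finiteDimensional_of_relQuot_bot {p : Submodule ℂ E} [FiniteDimensional ℂ (relQuot p ⊥)] :
    FiniteDimensional ℂ p := by
  refine Module.Finite.of_injective (Submodule.mkQ ((p ⊓ ⊥).comap p.subtype)) ?_
  rw [← LinearMap.ker_eq_bot, Submodule.ker_mkQ, eq_bot_iff]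
  intro x hx
  simpa using hx

lemma finiteDimensional_relQuot_mono {p p' q q' : Submodule ℂ E} (hp : p ≤ p') (hq : q' ≤ q)
    [FiniteDimensional ℂ (relQuot p' q')] : FiniteDimensional ℂ (relQuot p q) := by
  have h1 : FiniteDimensional ℂ (relQuot p q') := Module.Finite.of_injective
    (relQuotMap (p := p) (q := q') (p' := p') (q' := q') LinearMap.id (fun x hx => hp hx)
      (fun x _ hx => hx)) (relQuotMap_injective _ _ _ fun x _ hx => hx)
  exact Module.Finite.of_surjective
    (relQuotMap (p := p) (q := q') (p' := p) (q' := q) LinearMap.id (fun x hx => hx)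
      (fun x _ hx => hq hx)) (relQuotMap_surjective _ _ _ fun x hx => ⟨x, hx, by simp⟩)

lemma finrank_relQuot_inf (p q : Submodule ℂ E) :
    finrank ℂ (relQuot p (p ⊓ q)) = finrank ℂ (relQuot p q) := by
  have h : p ⊓ (p ⊓ q) = p ⊓ q := by rw [← inf_assoc, inf_idem]
  simp only [relQuot]
  rw [h]

lemma finiteDimensional_relQuot_inf (p q : Submodule ℂ E) [h : FiniteDimensional ℂ (relQuot p q)] :
    FiniteDimensional ℂ (relQuot p (p ⊓ q)) := by
  have e : p ⊓ (p ⊓ q) = p ⊓ q := by rw [← inf_assoc, inf_idem]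
  simp only [relQuot]
  rw [e]
  exact h

lemma relQuot_exact (p : Submodule ℂ E) {q r : Submodule ℂ E} (h : r ≤ q) :
    Function.Exact
      (relQuotMap (p := p ⊓ q) (q := r) (p' := p) (q' := r) LinearMap.id (fun _ hx => hx.1)
        (fun _ _ hx => hx))
      (relQuotMap (p := p) (q := r) (p' := p) (q' := q) LinearMap.id (fun _ hx => hx)
        (fun _ _ hx => h hx)) := by
  refine relQuotMap_exact _ _ _ _ _ _ fun y hy => ⟨fun hyq => ⟨y, ⟨hy, hyq⟩, by simp⟩, ?_⟩
  rintro ⟨x, hx, hxy⟩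
  have := q.sub_mem hx.2 (h hxy)
  simpa using this

lemma finiteDimensional_relQuot_trans {p q r : Submodule ℂ E}
    [FiniteDimensional ℂ (relQuot p q)] [FiniteDimensional ℂ (relQuot q r)] :
    FiniteDimensional ℂ (relQuot p r) := by
  have h1 : FiniteDimensional ℂ (relQuot (p ⊓ q) (q ⊓ r)) := by
    have : FiniteDimensional ℂ (relQuot (p ⊓ q) r) :=
      finiteDimensional_relQuot_mono (p' := q) (q' := r) inf_le_right le_rfl
    exact Module.Finite.of_injective
      (relQuotMap (p := p ⊓ q) (q := q ⊓ r) (p' := p ⊓ q) (q' := r) LinearMap.id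
        (fun _ hx => hx) (fun _ _ hx => hx.2))
      (relQuotMap_injective _ _ _ fun x hx hxr => ⟨hx.2, hxr⟩)
  have h2 : FiniteDimensional ℂ (relQuot p (q ⊓ r)) :=
    finiteDimensional_of_exact (relQuot_exact p (q := q) (r := q ⊓ r) inf_le_left)
  exact finiteDimensional_relQuot_mono (q' := q ⊓ r) le_rfl inf_le_right

lemma finrank_relQuot_add (p : Submodule ℂ E) {q r : Submodule ℂ E} (h : r ≤ q)
    [FiniteDimensional ℂ (relQuot p r)] :
    finrank ℂ (relQuot p r) = finrank ℂ (relQuot (p ⊓ q) r) + finrank ℂ (relQuot p q) :=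
  finrank_of_exact (relQuot_exact p h) (relQuotMap_injective _ _ _ fun x _ hx => hx)
    (relQuotMap_surjective _ _ _ fun x hx => ⟨x, hx, by simp⟩)

/-- Two subspaces are commensurable if each of them is contained in the other up to finite
dimension. -/
def Commens (p q : Submodule ℂ E) : Prop :=
  FiniteDimensional ℂ (relQuot p q) ∧ FiniteDimensional ℂ (relQuot q p)

/-- The relative dimension `dim p / (p ⊓ q) - dim q / (p ⊓ q)` of two subspaces. -/
def relDim (p q : Submodule ℂ E) : ℤ :=
  (finrank ℂ (relQuot p q) : ℤ) - finrank ℂ (relQuot q p)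

lemma Commens.symm {p q : Submodule ℂ E} (h : Commens p q) : Commens q p := ⟨h.2, h.1⟩

lemma Commens.trans {p q r : Submodule ℂ E} (h : Commens p q) (h' : Commens q r) :
    Commens p r := by
  obtain ⟨_, _⟩ := h
  obtain ⟨_, _⟩ := h'
  exact ⟨finiteDimensional_relQuot_trans (q := q), finiteDimensional_relQuot_trans (q := q)⟩

lemma relDim_comm (p q : Submodule ℂ E) : relDim q p = - relDim p q := by
  simp [relDim]

lemma relDim_eq_finrank {p q : Submodule ℂ E} (h : q ≤ p) :
    relDim p q = finrank ℂ (relQuot p q) := by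
  simp [relDim, finrank_relQuot_of_le h]

lemma relDim_eq_sub {p q r : Submodule ℂ E} (hp : r ≤ p) (hq : r ≤ q)
    [FiniteDimensional ℂ (relQuot p r)] [FiniteDimensional ℂ (relQuot q r)] :
    relDim p q = (finrank ℂ (relQuot p r) : ℤ) - finrank ℂ (relQuot q r) := by
  have h : finrank ℂ (relQuot (q ⊓ p) r) = finrank ℂ (relQuot (p ⊓ q) r) := by rw [inf_comm]
  rw [finrank_relQuot_add p hq, finrank_relQuot_add q hp, h, relDim]
  push_cast
  ring

lemma Commens.relDim_add {p q r : Submodule ℂ E} (h : Commens p q) (h' : Commens q r) :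
    relDim p q + relDim q r = relDim p r := by
  have key : ∀ a b c : Submodule ℂ E, Commens a b → Commens a c →
      FiniteDimensional ℂ (relQuot a (a ⊓ b ⊓ c)) := by
    rintro a b c ⟨_, _⟩ ⟨_, _⟩
    have h1 : FiniteDimensional ℂ (relQuot (a ⊓ b) (a ⊓ b ⊓ c)) := by
      have : FiniteDimensional ℂ (relQuot (a ⊓ b) c) :=
        finiteDimensional_relQuot_mono (p' := a) (q' := c) inf_le_left le_rfl
      exact Module.Finite.of_injective
        (relQuotMap (p := a ⊓ b) (q := a ⊓ b ⊓ c) (p' := a ⊓ b) (q' := c) LinearMap.id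
          (fun _ hx => hx) (fun _ _ hx => hx.2))
        (relQuotMap_injective _ _ _ fun x hx hxr => ⟨hx, hxr⟩)
    exact finiteDimensional_of_exact
      (relQuot_exact a (q := b) (r := a ⊓ b ⊓ c) (inf_le_left.trans inf_le_right))
  have hp := key p q r h (h.trans h')
  have hq : FiniteDimensional ℂ (relQuot q (p ⊓ q ⊓ r)) := by
    have := key q p r h.symm h'
    rwa [inf_comm q p] at this
  have hr : FiniteDimensional ℂ (relQuot r (p ⊓ q ⊓ r)) := by
    have := key r p q (h.trans h').symm h'.symm
    rwa [show r ⊓ p ⊓ q = p ⊓ q ⊓ r by rw [inf_assoc, inf_comm]] at this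
  rw [relDim_eq_sub (inf_le_left.trans inf_le_left : p ⊓ q ⊓ r ≤ p)
      (inf_le_left.trans inf_le_right), relDim_eq_sub (r := p ⊓ q ⊓ r)
      (inf_le_left.trans inf_le_right) inf_le_right, relDim_eq_sub (r := p ⊓ q ⊓ r)
      (inf_le_left.trans inf_le_left) inf_le_right]
  ring

/-- Rank-nullity relative to a subspace of finite codimension. -/
lemma finrank_relQuot_ker_add_range (T : E →ₗ[ℂ] F) (M : Submodule ℂ E)
    [FiniteDimensional ℂ (relQuot ⊤ M)] :
    FiniteDimensional ℂ (relQuot (LinearMap.ker T) M) ∧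
    FiniteDimensional ℂ (relQuot (LinearMap.range T) (M.map T)) ∧
    finrank ℂ (relQuot ⊤ M) =
      finrank ℂ (relQuot (LinearMap.ker T) M) + finrank ℂ (relQuot (LinearMap.range T) (M.map T)) := by
  have hs := relQuotMap_surjective (p := ⊤) (q := M) (p' := LinearMap.range T) (q' := M.map T) T
    (fun x _ => ⟨x, rfl⟩) (fun x _ hx => ⟨x, hx, rfl⟩)
    (by rintro _ ⟨x, rfl⟩; exact ⟨x, trivial, by simp⟩)
  refine ⟨finiteDimensional_relQuot_mono (p' := ⊤) le_top le_rfl, Module.Finite.of_surjective _ hs,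
    finrank_of_exact (relQuotMap_exact (p := LinearMap.ker T) (q := M) (p' := ⊤) LinearMap.id
      (fun _ _ => Submodule.mem_top) (fun _ _ hx => hx) _ _ _ fun y _ => ?_)
      (relQuotMap_injective _ _ _ fun x _ hx => hx) hs⟩
  constructor
  · rintro ⟨m, hm, hmy⟩
    refine ⟨y - m, by simp [hmy], by simpa using hm⟩
  · rintro ⟨x, hx, hxy⟩
    refine ⟨y - x, by simpa using M.neg_mem hxy, ?_⟩
    rw [map_sub, LinearMap.mem_ker.1 hx, sub_zero]

/-- The effect of a finite rank perturbation on kernel and range. -/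
lemma commens_of_finiteDimensional_range_sub (T T' : E →ₗ[ℂ] F)
    (h : FiniteDimensional ℂ (LinearMap.range (T - T'))) :
    Commens (LinearMap.ker T) (LinearMap.ker T') ∧
    Commens (LinearMap.range T) (LinearMap.range T') ∧
    relDim (LinearMap.ker T) (LinearMap.ker T') +
      relDim (LinearMap.range T) (LinearMap.range T') = 0 := by
  set M := LinearMap.ker (T - T') with hM
  have hMem : ∀ x ∈ M, T x = T' x := fun x hx => by
    rw [hM, LinearMap.mem_ker, LinearMap.sub_apply, sub_eq_zero] at hx; exact hx
  have hfin : FiniteDimensional ℂ (relQuot ⊤ M) := by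
    refine Module.Finite.of_injective (relQuotMap (p := ⊤) (q := M)
      (p' := LinearMap.range (T - T')) (q' := ⊥) (T - T') (fun x _ => ⟨x, rfl⟩)
      (fun x _ hx => by simpa [sub_eq_zero] using hMem x hx)) ?_
    exact relQuotMap_injective _ _ _ fun x _ hx => by simpa [hM] using hx
  obtain ⟨_, _, h3⟩ := finrank_relQuot_ker_add_range T M
  obtain ⟨_, _, h3'⟩ := finrank_relQuot_ker_add_range T' M
  have hmap : M.map T = M.map T' := by
    ext y
    constructor
    · rintro ⟨x, hx, rfl⟩; exact ⟨x, hx, (hMem x hx).symm⟩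
    · rintro ⟨x, hx, rfl⟩; exact ⟨x, hx, hMem x hx⟩
  have hker : LinearMap.ker T ⊓ M = LinearMap.ker T' ⊓ M := by
    ext x
    simp only [Submodule.mem_inf, LinearMap.mem_ker]
    exact ⟨fun hx => ⟨(hMem x hx.2).symm.trans hx.1, hx.2⟩,
      fun hx => ⟨(hMem x hx.2).trans hx.1, hx.2⟩⟩
  have e := finrank_relQuot_inf (LinearMap.ker T) M
  have e' : finrank ℂ (relQuot (LinearMap.ker T') (LinearMap.ker T ⊓ M)) =
      finrank ℂ (relQuot (LinearMap.ker T') M) := by rw [hker, finrank_relQuot_inf]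
  have : FiniteDimensional ℂ (relQuot (LinearMap.ker T) (LinearMap.ker T ⊓ M)) :=
    finiteDimensional_relQuot_inf _ _
  have : FiniteDimensional ℂ (relQuot (LinearMap.ker T') (LinearMap.ker T ⊓ M)) := by
    rw [hker]; exact finiteDimensional_relQuot_inf _ _
  have e'' : finrank ℂ (relQuot (LinearMap.range T') (M.map T)) =
      finrank ℂ (relQuot (LinearMap.range T') (M.map T')) := by rw [hmap]
  have i2 : FiniteDimensional ℂ (relQuot (LinearMap.range T') (M.map T)) := by
    rw [hmap]; infer_instance
  have hle : M.map T ≤ LinearMap.range T := LinearMap.map_le_range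
  have hle' : M.map T ≤ LinearMap.range T' := hmap ▸ LinearMap.map_le_range
  have hk' : LinearMap.ker T ⊓ M ≤ LinearMap.ker T' := hker ▸ inf_le_left
  refine ⟨⟨finiteDimensional_relQuot_mono (q' := LinearMap.ker T ⊓ M) le_rfl hk',
    finiteDimensional_relQuot_mono (q' := LinearMap.ker T ⊓ M) le_rfl inf_le_left⟩,
    ⟨finiteDimensional_relQuot_mono (q' := M.map T) le_rfl hle',
    finiteDimensional_relQuot_mono (q' := M.map T) le_rfl hle⟩, ?_⟩
  rw [relDim_eq_sub (r := LinearMap.ker T ⊓ M) inf_le_left hk', relDim_eq_sub hle hle', e, e', e'']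
  omega

end RelQuot

section Hilbert

variable {E F : Type*} [NormedAddCommGroup E] [InnerProductSpace ℂ E]
  [NormedAddCommGroup F] [InnerProductSpace ℂ F]

section FiniteRank

/-- Operators that are norm limits of finite rank operators. -/
def IsFiniteRankLimit (K : E →L[ℂ] F) : Prop :=
  ∀ ε : ℝ, 0 < ε → ∃ L : E →L[ℂ] F,
    FiniteDimensional ℂ (LinearMap.range L.toLinearMap) ∧ ‖K - L‖ < ε

lemma finiteDimensional_range_add {L L' : E →L[ℂ] F}
    (h : FiniteDimensional ℂ (LinearMap.range L.toLinearMap))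
    (h' : FiniteDimensional ℂ (LinearMap.range L'.toLinearMap)) :
    FiniteDimensional ℂ (LinearMap.range (L + L').toLinearMap) := by
  refine Submodule.finiteDimensional_of_le
    (S₂ := LinearMap.range L.toLinearMap ⊔ LinearMap.range L'.toLinearMap) ?_
  rintro _ ⟨x, rfl⟩
  exact Submodule.add_mem_sup ⟨x, rfl⟩ ⟨x, rfl⟩

lemma IsFiniteRankLimit.add {K K' : E →L[ℂ] F} (h : IsFiniteRankLimit K)
    (h' : IsFiniteRankLimit K') : IsFiniteRankLimit (K + K') := by
  intro ε hε
  obtain ⟨L, hL, hKL⟩ := h (ε / 2) (half_pos hε)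
  obtain ⟨L', hL', hKL'⟩ := h' (ε / 2) (half_pos hε)
  refine ⟨L + L', finiteDimensional_range_add hL hL', ?_⟩
  calc ‖K + K' - (L + L')‖ = ‖(K - L) + (K' - L')‖ := by congr 1; abel
    _ ≤ ‖K - L‖ + ‖K' - L'‖ := norm_add_le _ _
    _ < ε := by linarith

lemma isFiniteRankLimit_of_finiteDimensional {L : E →L[ℂ] F}
    (h : FiniteDimensional ℂ (LinearMap.range L.toLinearMap)) : IsFiniteRankLimit L :=
  fun ε hε => ⟨L, h, by simpa using hε⟩

lemma isFiniteRankLimit_of_isCompactOperator {K : E →L[ℂ] F} (hK : IsCompactOperator K) :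
    IsFiniteRankLimit K := by
  intro ε hε
  have hcpt := hK.isCompact_closure_image_closedBall (𝕜₁ := ℂ) (f := K.toLinearMap) 1
  obtain ⟨t, htf, ht⟩ := Metric.totallyBounded_iff.1 (hcpt.totallyBounded.subset subset_closure)
    (ε / 2) (half_pos hε)
  set V := Submodule.span ℂ t
  have : FiniteDimensional ℂ V := FiniteDimensional.span_of_finite ℂ htf
  refine ⟨V.starProjection ∘L K, Submodule.finiteDimensional_of_le (S₂ := V) ?_, ?_⟩
  · rintro _ ⟨x, rfl⟩
    exact V.starProjection_apply_mem _
  · refine lt_of_le_of_lt (ContinuousLinearMap.opNorm_le_of_unit_norm (C := ε / 2)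
      (half_pos hε).le fun x hx => ?_) (half_lt_self hε)
    obtain ⟨y, hy, hxy⟩ := Set.mem_iUnion₂.1 (ht ⟨x, by simp [hx], rfl⟩)
    have h1 : ‖K x - V.starProjection (K x)‖ ≤ ‖K x - y‖ := by
      rw [V.starProjection_minimal (K x)]
      exact ciInf_le (f := fun v : V => ‖K x - v‖) ⟨0, by rintro _ ⟨v, rfl⟩; positivity⟩
        ⟨y, Submodule.subset_span hy⟩
    have h2 : ‖K x - y‖ < ε / 2 := by simpa [dist_eq_norm] using hxy
    exact h1.trans h2.le

/-- A bounded operator has finite dimensional kernel and cokernel. -/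
def HasIndex (A : E →L[ℂ] F) : Prop :=
  Commens (LinearMap.ker A.toLinearMap) ⊥ ∧ Commens (LinearMap.range A.toLinearMap) ⊤

/-- The index, as a relative dimension. -/
def relIndex (A : E →L[ℂ] F) : ℤ :=
  relDim (LinearMap.ker A.toLinearMap) ⊥ + relDim (LinearMap.range A.toLinearMap) ⊤

lemma HasIndex.of_finiteDimensional_range_sub {A B : E →L[ℂ] F} (hA : HasIndex A)
    (h : FiniteDimensional ℂ (LinearMap.range (B - A).toLinearMap)) :
    HasIndex B ∧ relIndex B = relIndex A := by
  obtain ⟨hk, hr, he⟩ := commens_of_finiteDimensional_range_sub B.toLinearMap A.toLinearMap h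
  refine ⟨⟨hk.trans hA.1, hr.trans hA.2⟩, ?_⟩
  rw [relIndex, relIndex, ← hk.relDim_add hA.1, ← hr.relDim_add hA.2]
  linear_combination he

lemma HasIndex.comp_equiv {A : E →L[ℂ] F} (hA : HasIndex A) (U : E ≃L[ℂ] E) :
    HasIndex (A ∘L U.toContinuousLinearMap) ∧
      relIndex (A ∘L U.toContinuousLinearMap) = relIndex A := by
  have hr : LinearMap.range (A ∘L U.toContinuousLinearMap).toLinearMap =
      LinearMap.range A.toLinearMap := by
    ext y
    constructor
    · rintro ⟨x, rfl⟩; exact ⟨U x, rfl⟩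
    · rintro ⟨x, rfl⟩; exact ⟨U.symm x, congrArg A (U.apply_symm_apply x)⟩
  have hU : ∀ x ∈ LinearMap.ker (A ∘L U.toContinuousLinearMap).toLinearMap,
      U.toLinearEquiv.toLinearMap x ∈ LinearMap.ker A.toLinearMap := fun x hx => hx
  have hU0 : ∀ x ∈ LinearMap.ker (A ∘L U.toContinuousLinearMap).toLinearMap,
      x ∈ (⊥ : Submodule ℂ E) → U.toLinearEquiv.toLinearMap x ∈ (⊥ : Submodule ℂ E) :=
    fun x _ hx => by
      rw [(Submodule.mem_bot ℂ).1 hx, map_zero]; exact Submodule.zero_mem _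
  have hi := relQuotMap_injective _ hU hU0 fun x _ hx => by simpa using hx
  have hs := relQuotMap_surjective _ hU hU0 fun y hy =>
    ⟨U.symm y, by simpa using hy, by simp⟩
  have hA1 := hA.1.1
  have hk := (LinearEquiv.ofBijective _ ⟨hi, hs⟩).finrank_eq
  refine ⟨⟨⟨Module.Finite.of_injective _ hi, ?_⟩, hr ▸ hA.2⟩, ?_⟩
  · have := subsingleton_relQuot (bot_le (a := LinearMap.ker (A ∘L U.toContinuousLinearMap).toLinearMap))
    infer_instance
  · rw [relIndex, relIndex, hr, relDim_eq_finrank bot_le, relDim_eq_finrank bot_le, hk]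

end FiniteRank

variable [CompleteSpace E] [CompleteSpace F]

/-- A bounded operator whose range has finite codimension has a bounded generalized inverse. -/
lemma exists_generalized_inverse (A : E →L[ℂ] F)
    [FiniteDimensional ℂ (relQuot ⊤ (LinearMap.range A.toLinearMap))] :
    ∃ G : F →L[ℂ] E, ∀ z, A (G (A z)) = A z := by
  set R := LinearMap.range A.toLinearMap with hR
  have hfin : FiniteDimensional ℂ (F ⧸ R) := by
    refine Module.Finite.of_surjective (Submodule.mapQ ((⊤ ⊓ R).comap (⊤ : Submodule ℂ F).subtype) R
      (⊤ : Submodule ℂ F).subtype fun x hx => hx.2) ?_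
    intro a
    induction a using Submodule.Quotient.induction_on with | _ y
    exact ⟨Submodule.Quotient.mk ⟨y, trivial⟩, rfl⟩
  obtain ⟨C, hC⟩ := R.exists_isCompl
  have : FiniteDimensional ℂ C :=
    Module.Finite.equiv (Submodule.quotientEquivOfIsCompl R C hC)
  set N := LinearMap.ker A.toLinearMap with hN
  have hNc : IsClosed (N : Set E) := A.isClosed_ker
  have : CompleteSpace N := hNc.completeSpace_coe
  let J : (Nᗮ × C) →L[ℂ] F := (A ∘L Nᗮ.subtypeL).coprod C.subtypeL
  have hA : ∀ z, A (z - N.starProjection z) = A z := fun z => by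
    have h0 : A (N.starProjection z) = 0 := N.starProjection_apply_mem z
    rw [map_sub, h0, sub_zero]
  have hmem : ∀ z, z - N.starProjection z ∈ Nᗮ := fun z =>
    N.sub_starProjection_mem_orthogonal z
  have hinj : LinearMap.ker J.toLinearMap = ⊥ := by
    rw [LinearMap.ker_eq_bot']
    rintro ⟨x, c⟩ h
    have h : A x + c = 0 := h
    have hc : (c : F) = 0 := by
      refine (Submodule.disjoint_def.1 hC.disjoint) c ?_ c.2
      rw [← neg_eq_of_add_eq_zero_right h]
      exact R.neg_mem ⟨x, rfl⟩
    have hx : (x : E) ∈ N := by rw [hc, add_zero] at h; exact h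
    have hx0 : (x : E) = 0 := by
      have := x.2 x hx
      simpa using this
    ext <;> simp [hx0, hc]
  have hsurj : LinearMap.range J.toLinearMap = ⊤ := by
    rw [LinearMap.range_eq_top]
    intro y
    have hy : y ∈ R ⊔ C := hC.sup_eq_top ▸ Submodule.mem_top
    obtain ⟨_, ⟨z, rfl⟩, c, hc, rfl⟩ := Submodule.mem_sup.1 hy
    refine ⟨(⟨_, hmem z⟩, ⟨c, hc⟩), ?_⟩
    change A (z - N.starProjection z) + c = A z + c
    rw [hA]
  let e := ContinuousLinearEquiv.ofBijective J hinj hsurj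
  refine ⟨Nᗮ.subtypeL ∘L ContinuousLinearMap.fst ℂ _ _ ∘L e.symm.toContinuousLinearMap, fun z => ?_⟩
  have h1 : e (⟨_, hmem z⟩, 0) = A z := by
    change A (z - N.starProjection z) + ((0 : C) : F) = A z
    rw [hA]; simp
  have h2 : e.symm (A z) = (⟨_, hmem z⟩, 0) := by rw [← h1, e.symm_apply_apply]
  change A ((e.symm (A z)).1 : Nᗮ) = A z
  rw [h2]
  exact hA z

/-- A bounded operator whose range has finite codimension in a closed subspace has a bounded
generalized inverse. -/
lemma exists_generalized_inverse_of_le (A : E →L[ℂ] F) {W : Submodule ℂ F}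
    (hW : IsClosed (W : Set F)) (hAW : LinearMap.range A.toLinearMap ≤ W)
    [FiniteDimensional ℂ (relQuot W (LinearMap.range A.toLinearMap))] :
    ∃ G : F →L[ℂ] E, ∀ z, A (G (A z)) = A z := by
  have : CompleteSpace W := hW.completeSpace_coe
  have hA : ∀ z, A z ∈ W := fun z => hAW ⟨z, rfl⟩
  let B : E →L[ℂ] W := A.codRestrict W hA
  have : FiniteDimensional ℂ (relQuot ⊤ (LinearMap.range B.toLinearMap)) := by
    refine Module.Finite.of_injective (relQuotMap (p' := W) (q' := LinearMap.range A.toLinearMap)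
      W.subtype (fun x _ => x.2) ?_) (relQuotMap_injective _ _ _ ?_)
    · rintro _ _ ⟨z, rfl⟩
      exact ⟨z, rfl⟩
    · rintro x _ ⟨z, hz⟩
      exact ⟨z, Subtype.ext hz⟩
  obtain ⟨G, hG⟩ := exists_generalized_inverse B
  refine ⟨G ∘L W.orthogonalProjectionOnto, fun z => ?_⟩
  have h1 : W.orthogonalProjectionOnto (A z) = B z :=
    Submodule.orthogonalProjectionOnto_mem_subspace_eq_self (B z)
  have h2 : A (G (B z)) = A z := congrArg Subtype.val (hG z)
  change A (G (W.orthogonalProjectionOnto (A z))) = A z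
  rw [h1, h2]

lemma finiteDimensional_range_adjoint {L : E →L[ℂ] F}
    (h : FiniteDimensional ℂ (LinearMap.range L.toLinearMap)) :
    FiniteDimensional ℂ (LinearMap.range (adjoint L).toLinearMap) := by
  set R := LinearMap.range L.toLinearMap
  refine Submodule.finiteDimensional_of_le (S₂ := R.map (adjoint L).toLinearMap) ?_
  rintro _ ⟨y, rfl⟩
  refine ⟨R.starProjection y, R.starProjection_apply_mem y, ?_⟩
  have h1 : y - R.starProjection y ∈ LinearMap.ker (adjoint L).toLinearMap := by
    rw [← ContinuousLinearMap.orthogonal_range]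
    exact R.sub_starProjection_mem_orthogonal y
  rw [LinearMap.mem_ker, map_sub, sub_eq_zero] at h1
  exact h1.symm

lemma IsFiniteRankLimit.adjoint {K : E →L[ℂ] F} (h : IsFiniteRankLimit K) :
    IsFiniteRankLimit (ContinuousLinearMap.adjoint K) := by
  intro ε hε
  obtain ⟨L, hL, hKL⟩ := h ε hε
  refine ⟨ContinuousLinearMap.adjoint L, finiteDimensional_range_adjoint hL, ?_⟩
  rwa [← map_sub, LinearIsometryEquiv.norm_map]

lemma HasIndex.add {A K : E →L[ℂ] F} (hA : HasIndex A) (hK : IsFiniteRankLimit K) :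
    HasIndex (A + K) ∧ relIndex (A + K) = relIndex A := by
  have := hA.2.2
  obtain ⟨G, hG⟩ := exists_generalized_inverse A
  obtain ⟨L, hL, hKL⟩ := hK (1 / (‖G‖ + 1)) (by positivity)
  set D := K - L with hD
  have hGD : ‖-(G ∘L D)‖ < 1 := by
    rw [norm_neg]
    calc ‖G ∘L D‖ ≤ ‖G‖ * ‖D‖ := ContinuousLinearMap.opNorm_comp_le _ _
      _ ≤ (‖G‖ + 1) * ‖D‖ := by gcongr; linarith
      _ < (‖G‖ + 1) * (1 / (‖G‖ + 1)) := by gcongr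
      _ = 1 := by field_simp
  let U := ContinuousLinearEquiv.ofUnit (Units.oneSub (-(G ∘L D)) hGD)
  have hU : ∀ x, U x = x + G (D x) := fun x => by
    change ((1 : E →L[ℂ] E) - -(G ∘L D)) x = _
    simp
  obtain ⟨h1, h2⟩ := hA.comp_equiv U
  have hfin : FiniteDimensional ℂ
      (LinearMap.range (ContinuousLinearMap.id ℂ F - A ∘L G).toLinearMap) := by
    have h : FiniteDimensional ℂ (relQuot
        (LinearMap.range (ContinuousLinearMap.id ℂ F - A ∘L G).toLinearMap) ⊥) := by
      refine Module.Finite.of_surjective (relQuotMap (p := ⊤)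
        (q := LinearMap.range A.toLinearMap)
        (p' := LinearMap.range (ContinuousLinearMap.id ℂ F - A ∘L G).toLinearMap) (q' := ⊥)
        (ContinuousLinearMap.id ℂ F - A ∘L G).toLinearMap (fun x _ => ⟨x, rfl⟩) ?_)
        (relQuotMap_surjective _ _ _ ?_)
      · rintro _ _ ⟨z, rfl⟩
        simp [hG]
      · rintro _ ⟨x, rfl⟩
        exact ⟨x, trivial, by simp⟩
    exact finiteDimensional_of_relQuot_bot
  have hB : A + K - A ∘L U.toContinuousLinearMap =
      (ContinuousLinearMap.id ℂ F - A ∘L G) ∘L D + L := by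
    ext x
    change A x + K x - A (U x) = D x - A (G (D x)) + L x
    rw [hU, map_add, hD]
    simp only [sub_apply]
    abel
  obtain ⟨h3, h4⟩ := h1.of_finiteDimensional_range_sub (B := A + K) (by
    rw [hB]
    refine finiteDimensional_range_add (Submodule.finiteDimensional_of_le (S₂ := LinearMap.range
      (ContinuousLinearMap.id ℂ F - A ∘L G).toLinearMap) ?_) hL
    rintro _ ⟨x, rfl⟩
    exact ⟨D x, rfl⟩)
  exact ⟨h3, h4.trans h2⟩

end Hilbert

section Pair

variable {E F : Type*} [NormedAddCommGroup E] [InnerProductSpace ℂ E]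
  [NormedAddCommGroup F] [InnerProductSpace ℂ F]

lemma isFredholmPair_iff {S : E →L[ℂ] F} {T : F →L[ℂ] E} : IsFredholmPair S T ↔
    Commens (LinearMap.ker S.toLinearMap) (LinearMap.range T.toLinearMap) ∧
    Commens (LinearMap.ker T.toLinearMap) (LinearMap.range S.toLinearMap) := by
  simp only [IsFredholmPair, Commens, and_assoc]

lemma pairIndex_eq (S : E →L[ℂ] F) (T : F →L[ℂ] E) : pairIndex S T =
    relDim (LinearMap.ker S.toLinearMap) (LinearMap.range T.toLinearMap) -
    relDim (LinearMap.ker T.toLinearMap) (LinearMap.range S.toLinearMap) := by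
  rw [pairIndex, relDim, relDim]
  ring

lemma range_le_ker {P : E →L[ℂ] F} {Q : F →L[ℂ] E} (h : P ∘L Q = 0) :
    LinearMap.range Q.toLinearMap ≤ LinearMap.ker P.toLinearMap := by
  rintro _ ⟨x, rfl⟩
  exact DFunLike.congr_fun h x

lemma finiteDimensional_range_sub_comm {P Q : E →L[ℂ] F}
    (h : FiniteDimensional ℂ (LinearMap.range (P - Q).toLinearMap)) :
    FiniteDimensional ℂ (LinearMap.range (Q - P).toLinearMap) := by
  refine Submodule.finiteDimensional_of_le (S₂ := LinearMap.range (P - Q).toLinearMap) ?_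
  rintro _ ⟨x, rfl⟩
  exact ⟨-x, by simp [sub_eq_add_neg, add_comm]⟩

/-- Finite rank perturbations preserve Fredholm pairs and their index. -/
lemma IsFredholmPair.of_finiteDimensional_range_sub {S S' : E →L[ℂ] F} {T T' : F →L[ℂ] E}
    (h : IsFredholmPair S T)
    (hS : FiniteDimensional ℂ (LinearMap.range (S' - S).toLinearMap))
    (hT : FiniteDimensional ℂ (LinearMap.range (T' - T).toLinearMap)) :
    IsFredholmPair S' T' ∧ pairIndex S' T' = pairIndex S T := by
  rw [isFredholmPair_iff] at h
  obtain ⟨a1, a2, a3⟩ := commens_of_finiteDimensional_range_sub S'.toLinearMap S.toLinearMap hS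
  obtain ⟨b1, b2, b3⟩ := commens_of_finiteDimensional_range_sub T'.toLinearMap T.toLinearMap hT
  refine ⟨isFredholmPair_iff.2 ⟨(a1.trans h.1).trans b2.symm, (b1.trans h.2).trans a2.symm⟩, ?_⟩
  rw [pairIndex_eq, pairIndex_eq, ← (a1.trans h.1).relDim_add b2.symm, ← a1.relDim_add h.1,
    ← (b1.trans h.2).relDim_add a2.symm, ← b1.relDim_add h.2, 
    relDim_comm (LinearMap.range T'.toLinearMap) (LinearMap.range T.toLinearMap),
    relDim_comm (LinearMap.range S'.toLinearMap) (LinearMap.range S.toLinearMap)]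
  linear_combination a3 - b3

variable [CompleteSpace E]

/-- If `S T` has finite rank then so does the part of `T` orthogonal to the kernel of `S`. -/
lemma exists_finiteDimensional_range_sub {S : E →L[ℂ] F} {T : F →L[ℂ] E}
    [FiniteDimensional ℂ
      (relQuot (LinearMap.range T.toLinearMap) (LinearMap.ker S.toLinearMap))] :
    ∃ T' : F →L[ℂ] E, S ∘L T' = 0 ∧ (∀ y, T y = 0 → T' y = 0) ∧
      FiniteDimensional ℂ (LinearMap.range (T' - T).toLinearMap) := by
  set N := LinearMap.ker S.toLinearMap
  have : CompleteSpace N := S.isClosed_ker.completeSpace_coe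
  have hfix : ∀ x, T x ∈ N → (N.starProjection ∘L T) x = T x := fun x hx =>
    Submodule.starProjection_eq_self_iff.2 hx
  refine ⟨N.starProjection ∘L T, ?_, fun y hy => by simp [hy], ?_⟩
  · ext y
    exact N.starProjection_apply_mem (T y)
  · have h : FiniteDimensional ℂ
        (relQuot (LinearMap.range (N.starProjection ∘L T - T).toLinearMap) ⊥) := by
      refine Module.Finite.of_surjective (relQuotMap (p := LinearMap.range T.toLinearMap) (q := N)
        (p' := LinearMap.range (N.starProjection ∘L T - T).toLinearMap) (q' := ⊥)
        (N.starProjection - ContinuousLinearMap.id ℂ E).toLinearMap ?_ ?_)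
        (relQuotMap_surjective _ _ _ ?_)
      · rintro _ ⟨x, rfl⟩
        exact ⟨x, rfl⟩
      · rintro _ ⟨x, rfl⟩ hx
        rw [Submodule.mem_bot]
        exact sub_eq_zero.2 (hfix x hx)
      · rintro _ ⟨x, rfl⟩
        exact ⟨T x, ⟨x, rfl⟩, by simp⟩
    exact finiteDimensional_of_relQuot_bot

variable [CompleteSpace F]

lemma range_le_range_add_adjoint {S : E →L[ℂ] F} {T : F →L[ℂ] E} (hST : S ∘L T = 0) :
    LinearMap.range S.toLinearMap ≤ LinearMap.range (S + adjoint T).toLinearMap := by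
  rintro _ ⟨x, rfl⟩
  set N := LinearMap.ker S.toLinearMap
  have : CompleteSpace N := S.isClosed_ker.completeSpace_coe
  have h1 : x - N.starProjection x ∈ LinearMap.ker (adjoint T).toLinearMap := by
    rw [← ContinuousLinearMap.orthogonal_range]
    refine Submodule.orthogonal_le ?_ (N.sub_starProjection_mem_orthogonal x)
    rintro _ ⟨y, rfl⟩
    exact DFunLike.congr_fun hST y
  have h2 : S (N.starProjection x) = 0 := N.starProjection_apply_mem x
  have h1 : adjoint T (x - N.starProjection x) = 0 := h1
  refine ⟨x - N.starProjection x, ?_⟩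
  change S (x - N.starProjection x) + adjoint T (x - N.starProjection x) = S x
  rw [h1, map_sub, h2]
  simp

lemma mem_range_of_mem_range_add_adjoint {S : E →L[ℂ] F} {T : F →L[ℂ] E} (hTS : T ∘L S = 0) {y : F}
    (hy : T y = 0) (h : y ∈ LinearMap.range (S + adjoint T).toLinearMap) :
    y ∈ LinearMap.range S.toLinearMap := by
  obtain ⟨x, rfl⟩ := h
  change T (S x + adjoint T x) = 0 at hy
  have h1 : T (S x) = 0 := DFunLike.congr_fun hTS x
  have h2 : x ∈ (T ∘L adjoint T).ker := by
    rw [map_add, h1, zero_add] at hy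
    exact hy
  rw [ContinuousLinearMap.ker_self_comp_adjoint] at h2
  have h2 : adjoint T x = 0 := h2
  refine ⟨x, ?_⟩
  change S x = S x + adjoint T x
  rw [h2, add_zero]

lemma orthogonal_ker_le_range_add_adjoint {S : E →L[ℂ] F} {T : F →L[ℂ] E} (hST : S ∘L T = 0)
    [FiniteDimensional ℂ
      (relQuot (LinearMap.ker S.toLinearMap) (LinearMap.range T.toLinearMap))] :
    (LinearMap.ker T.toLinearMap)ᗮ ≤ LinearMap.range (S + adjoint T).toLinearMap := by
  set N := LinearMap.ker S.toLinearMap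
  have : CompleteSpace N := S.isClosed_ker.completeSpace_coe
  have hle : LinearMap.range T.toLinearMap ≤ N := by
    rintro _ ⟨y, rfl⟩
    exact DFunLike.congr_fun hST y
  obtain ⟨G, hG⟩ := exists_generalized_inverse_of_le T S.isClosed_ker hle
  intro w hw
  set u := adjoint G w
  have h1 : u - N.starProjection u ∈ LinearMap.ker (adjoint T).toLinearMap := by
    rw [← ContinuousLinearMap.orthogonal_range]
    exact Submodule.orthogonal_le hle (N.sub_starProjection_mem_orthogonal u)
  have h1 : adjoint T (u - N.starProjection u) = 0 := h1
  have h2 : S (N.starProjection u) = 0 := N.starProjection_apply_mem u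
  have h3 : adjoint T u = w := by
    refine ext_inner_right ℂ fun z => ?_
    rw [ContinuousLinearMap.adjoint_inner_left, ContinuousLinearMap.adjoint_inner_left,
      ← sub_eq_zero, ← inner_sub_right]
    refine Submodule.inner_left_of_mem_orthogonal (K := LinearMap.ker T.toLinearMap) ?_ hw
    change T (G (T z) - z) = 0
    rw [map_sub, hG, sub_self]
  refine ⟨N.starProjection u, ?_⟩
  change S (N.starProjection u) + adjoint T (N.starProjection u) = w
  rw [h2, zero_add, ← h3]
  rw [map_sub, sub_eq_zero] at h1
  exact h1.symm

lemma relQuotMap_ker_range_injective {S : E →L[ℂ] F} {T : F →L[ℂ] E} (hST : S ∘L T = 0)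
    (hTS : T ∘L S = 0) : Function.Injective
      (relQuotMap (p := LinearMap.ker T.toLinearMap) (q := LinearMap.range S.toLinearMap) (p' := ⊤)
        (q' := LinearMap.range (S + adjoint T).toLinearMap) LinearMap.id
        (fun _ _ => Submodule.mem_top) (fun _ _ hx => range_le_range_add_adjoint hST hx)) :=
  relQuotMap_injective _ _ _ fun _ hx h => mem_range_of_mem_range_add_adjoint hTS hx h

lemma finrank_relQuot_range_add_adjoint {S : E →L[ℂ] F} {T : F →L[ℂ] E} (hST : S ∘L T = 0)
    (hTS : T ∘L S = 0)
    [FiniteDimensional ℂ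
      (relQuot (LinearMap.ker S.toLinearMap) (LinearMap.range T.toLinearMap))]
    [FiniteDimensional ℂ
      (relQuot (LinearMap.ker T.toLinearMap) (LinearMap.range S.toLinearMap))] :
    FiniteDimensional ℂ (relQuot ⊤ (LinearMap.range (S + adjoint T).toLinearMap)) ∧
    finrank ℂ (relQuot ⊤ (LinearMap.range (S + adjoint T).toLinearMap)) =
      finrank ℂ (relQuot (LinearMap.ker T.toLinearMap) (LinearMap.range S.toLinearMap)) := by
  have hi := relQuotMap_ker_range_injective hST hTS
  set N := LinearMap.ker T.toLinearMap
  have : CompleteSpace N := T.isClosed_ker.completeSpace_coe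
  have hs : Function.Surjective
      (relQuotMap (p := LinearMap.ker T.toLinearMap) (q := LinearMap.range S.toLinearMap) (p' := ⊤)
        (q' := LinearMap.range (S + adjoint T).toLinearMap) LinearMap.id
        (fun _ _ => Submodule.mem_top) (fun _ _ hx => range_le_range_add_adjoint hST hx)) := by
    refine relQuotMap_surjective _ _ _ fun y _ => ⟨N.starProjection y,
      N.starProjection_apply_mem y, ?_⟩
    have := Submodule.neg_mem _ (orthogonal_ker_le_range_add_adjoint hST
      (N.sub_starProjection_mem_orthogonal y))
    rwa [neg_sub] at this
  exact ⟨Module.Finite.of_surjective _ hs, (LinearEquiv.ofBijective _ ⟨hi, hs⟩).finrank_eq.symm⟩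

lemma finrank_ker_eq_finrank_relQuot_range_adjoint (A : E →L[ℂ] F)
    [FiniteDimensional ℂ (relQuot ⊤ (LinearMap.range (adjoint A).toLinearMap))] :
    FiniteDimensional ℂ (relQuot (LinearMap.ker A.toLinearMap) ⊥) ∧
    finrank ℂ (relQuot (LinearMap.ker A.toLinearMap) ⊥) =
      finrank ℂ (relQuot ⊤ (LinearMap.range (adjoint A).toLinearMap)) := by
  set R := LinearMap.range (adjoint A).toLinearMap with hR
  have hk : Rᗮ = LinearMap.ker A.toLinearMap := by
    rw [hR, ContinuousLinearMap.orthogonal_range, ContinuousLinearMap.adjoint_adjoint]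
  obtain ⟨G, hG⟩ := exists_generalized_inverse (adjoint A)
  have hcl : IsClosed (R : Set E) := by
    have : R = LinearMap.ker (ContinuousLinearMap.id ℂ E - adjoint A ∘L G).toLinearMap := by
      ext x
      constructor
      · rintro ⟨z, rfl⟩
        simp [hG]
      · intro hx
        refine ⟨G x, ?_⟩
        have hx : x - adjoint A (G x) = 0 := hx
        exact (sub_eq_zero.1 hx).symm
    rw [this]
    exact ContinuousLinearMap.isClosed_ker _
  have : CompleteSpace R := hcl.completeSpace_coe
  rw [← hk]
  have hq : ∀ x ∈ Rᗮ, x ∈ (⊥ : Submodule ℂ E) → LinearMap.id (R := ℂ) x ∈ R := fun x _ hx => by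
    rw [(Submodule.mem_bot ℂ).1 hx]; exact R.zero_mem
  have hi := relQuotMap_injective (p' := ⊤) LinearMap.id (fun _ _ => Submodule.mem_top) hq
    fun x hx hxR => by simpa using hx x hxR
  have hs := relQuotMap_surjective (p' := ⊤) LinearMap.id (fun _ _ => Submodule.mem_top) hq
    fun y _ => ⟨y - R.starProjection y, R.sub_starProjection_mem_orthogonal y, by
      simp⟩
  exact ⟨Module.Finite.of_injective _ hi, (LinearEquiv.ofBijective _ ⟨hi, hs⟩).finrank_eq⟩

lemma adjoint_add_adjoint (S : E →L[ℂ] F) (T : F →L[ℂ] E) :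
    adjoint (S + adjoint T) = T + adjoint S := by
  rw [map_add, ContinuousLinearMap.adjoint_adjoint, add_comm]

/-- A Fredholm pair with `S T = 0` and `T S = 0` yields an operator `S + T*` of the same index. -/
lemma hasIndex_add_adjoint {S : E →L[ℂ] F} {T : F →L[ℂ] E} (hST : S ∘L T = 0) (hTS : T ∘L S = 0)
    [FiniteDimensional ℂ
      (relQuot (LinearMap.ker S.toLinearMap) (LinearMap.range T.toLinearMap))]
    [FiniteDimensional ℂ
      (relQuot (LinearMap.ker T.toLinearMap) (LinearMap.range S.toLinearMap))] :
    HasIndex (S + adjoint T) ∧ relIndex (S + adjoint T) =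
      finrank ℂ (relQuot (LinearMap.ker S.toLinearMap) (LinearMap.range T.toLinearMap)) -
      finrank ℂ (relQuot (LinearMap.ker T.toLinearMap) (LinearMap.range S.toLinearMap)) := by
  obtain ⟨h1, h2⟩ := finrank_relQuot_range_add_adjoint hST hTS
  obtain ⟨h3, h4⟩ := finrank_relQuot_range_add_adjoint hTS hST
  rw [← adjoint_add_adjoint] at h3 h4
  obtain ⟨h5, h6⟩ := finrank_ker_eq_finrank_relQuot_range_adjoint (S + adjoint T)
  have := subsingleton_relQuot (bot_le (a := LinearMap.ker (S + adjoint T).toLinearMap))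
  have := subsingleton_relQuot (le_top (a := LinearMap.range (S + adjoint T).toLinearMap))
  refine ⟨⟨⟨h5, inferInstance⟩, ⟨inferInstance, h1⟩⟩, ?_⟩
  rw [relIndex, relDim_eq_finrank bot_le, relDim_comm, relDim_eq_finrank le_top, h6, h4, h2]
  ring

/-- A pair of operators whose products have finite rank is a finite rank perturbation of a pair
with vanishing products. -/
lemma exists_comp_eq_zero (S : E →L[ℂ] F) (T : F →L[ℂ] E)
    [FiniteDimensional ℂ
      (relQuot (LinearMap.range T.toLinearMap) (LinearMap.ker S.toLinearMap))]
    [FiniteDimensional ℂ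
      (relQuot (LinearMap.range S.toLinearMap) (LinearMap.ker T.toLinearMap))] :
    ∃ (S' : E →L[ℂ] F) (T' : F →L[ℂ] E), S' ∘L T' = 0 ∧ T' ∘L S' = 0 ∧
      FiniteDimensional ℂ (LinearMap.range (S' - S).toLinearMap) ∧
      FiniteDimensional ℂ (LinearMap.range (T' - T).toLinearMap) := by
  obtain ⟨T', h1, h2, h4⟩ := exists_finiteDimensional_range_sub (S := S) (T := T)
  obtain ⟨S', k1, k2, k4⟩ := exists_finiteDimensional_range_sub (S := T) (T := S)
  refine ⟨S', T', ?_, ?_, k4, h4⟩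
  · ext y
    exact k2 _ (DFunLike.congr_fun h1 y)
  · ext x
    exact h2 _ (DFunLike.congr_fun k1 x)

/-- Stability of Fredholm pairs under perturbation by limits of finite rank operators. -/
theorem IsFredholmPair.stability {S S' : E →L[ℂ] F} {T T' : F →L[ℂ] E} (h : IsFredholmPair S T)
    (hS : IsFiniteRankLimit (S' - S)) (hT : IsFiniteRankLimit (T' - T))
    [FiniteDimensional ℂ
      (relQuot (LinearMap.range T'.toLinearMap) (LinearMap.ker S'.toLinearMap))]
    [FiniteDimensional ℂ
      (relQuot (LinearMap.range S'.toLinearMap) (LinearMap.ker T'.toLinearMap))] :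
    IsFredholmPair S' T' ∧ pairIndex S' T' = pairIndex S T := by
  have := h.2.1
  have := h.2.2.2
  obtain ⟨S₀, T₀, hST, hTS, hS₀, hT₀⟩ := exists_comp_eq_zero S T
  obtain ⟨S₁, T₁, hST', hTS', hS₁, hT₁⟩ := exists_comp_eq_zero S' T'
  obtain ⟨h₀, e₀⟩ := h.of_finiteDimensional_range_sub hS₀ hT₀
  have dS : IsFiniteRankLimit (S₁ - S₀) := by
    rw [show S₁ - S₀ = (S₁ - S') + (S' - S) + (S - S₀) by abel]
    exact ((isFiniteRankLimit_of_finiteDimensional hS₁).add hS).add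
      (isFiniteRankLimit_of_finiteDimensional (finiteDimensional_range_sub_comm hS₀))
  have dT : IsFiniteRankLimit (T₁ - T₀) := by
    rw [show T₁ - T₀ = (T₁ - T') + (T' - T) + (T - T₀) by abel]
    exact ((isFiniteRankLimit_of_finiteDimensional hT₁).add hT).add
      (isFiniteRankLimit_of_finiteDimensional (finiteDimensional_range_sub_comm hT₀))
  have := h₀.1
  have := h₀.2.2.1
  obtain ⟨i₀, j₀⟩ := hasIndex_add_adjoint hST hTS
  obtain ⟨i₁, j₁⟩ := i₀.add (dS.add dT.adjoint)
  obtain ⟨i₀', -⟩ := hasIndex_add_adjoint hTS hST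
  obtain ⟨i₁', -⟩ := i₀'.add (dT.add dS.adjoint)
  rw [show S₀ + adjoint T₀ + (S₁ - S₀ + adjoint (T₁ - T₀)) = S₁ + adjoint T₁ by
    rw [map_sub]; abel] at i₁ j₁
  rw [show T₀ + adjoint S₀ + (T₁ - T₀ + adjoint (S₁ - S₀)) = T₁ + adjoint S₁ by
    rw [map_sub]; abel] at i₁'
  have := i₁.2.2
  have := i₁'.2.2
  have f₁ := Module.Finite.of_injective _ (relQuotMap_ker_range_injective hST' hTS')
  have f₁' := Module.Finite.of_injective _ (relQuotMap_ker_range_injective hTS' hST')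
  obtain ⟨-, j₁'⟩ := hasIndex_add_adjoint hST' hTS'
  have s₁ := subsingleton_relQuot (range_le_ker hST')
  have s₂ := subsingleton_relQuot (range_le_ker hTS')
  have h₁ : IsFredholmPair S₁ T₁ := ⟨f₁', inferInstance, f₁, inferInstance⟩
  obtain ⟨h', e'⟩ := h₁.of_finiteDimensional_range_sub (finiteDimensional_range_sub_comm hS₁) (finiteDimensional_range_sub_comm hT₁)
  refine ⟨h', ?_⟩
  rw [e', ← e₀, pairIndex_eq, pairIndex_eq, relDim_eq_finrank (range_le_ker hST'), relDim_eq_finrank (range_le_ker hTS'),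
    relDim_eq_finrank (range_le_ker hST), relDim_eq_finrank (range_le_ker hTS), ← j₀, ← j₁', j₁]

end Pair

section Pi

variable {ι : Type*} {V : ι → Type*} [∀ i, NormedAddCommGroup (V i)]
  [∀ i, InnerProductSpace ℂ (V i)] {P Q : Submodule ℂ (PiLp 2 V)} {p q : ∀ i, Submodule ℂ (V i)}

lemma finiteDimensional_relQuot_of_pi (hP : ∀ x, x ∈ P ↔ ∀ i, x i ∈ p i)
    (hQ : ∀ x, x ∈ Q ↔ ∀ i, x i ∈ q i) [FiniteDimensional ℂ (relQuot P Q)] (i : ι) :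
    FiniteDimensional ℂ (relQuot (p i) (q i)) := by
  classical
  refine Module.Finite.of_surjective (relQuotMap (p := P) (q := Q) (PiLp.projₗ 2 V i)
    (fun x hx => (hP x).1 hx i) (fun x _ hx => (hQ x).1 hx i))
    (relQuotMap_surjective _ _ _ fun y hy =>
      ⟨WithLp.toLp 2 (Pi.single i y), (hP _).2 fun j => ?_, ?_⟩)
  · change Pi.single i y j ∈ p j
    rcases eq_or_ne j i with rfl | h
    · simpa using hy
    · simp [h]
  · simp

variable [Fintype ι]

lemma finiteDimensional_relQuot_pi (hP : ∀ x, x ∈ P ↔ ∀ i, x i ∈ p i)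
    (hQ : ∀ x, x ∈ Q ↔ ∀ i, x i ∈ q i) [∀ i, FiniteDimensional ℂ (relQuot (p i) (q i))] :
    FiniteDimensional ℂ (relQuot P Q) ∧
      finrank ℂ (relQuot P Q) = ∑ i, finrank ℂ (relQuot (p i) (q i)) := by
  let φ : relQuot P Q →ₗ[ℂ] ∀ i, relQuot (p i) (q i) := LinearMap.pi fun i =>
    relQuotMap (PiLp.projₗ 2 V i) (fun x hx => (hP x).1 hx i) (fun x _ hx => (hQ x).1 hx i)
  have hi : Function.Injective φ := by
    rw [injective_iff_map_eq_zero]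
    intro a ha
    induction a using Submodule.Quotient.induction_on with | _ x
    rw [relQuot_mk_eq_zero, hQ]
    intro i
    have := congrFun ha i
    exact (relQuot_mk_eq_zero _).1 this
  have hs : Function.Surjective φ := by
    intro b
    choose z hz using fun i => Submodule.Quotient.mk_surjective _ (b i)
    refine ⟨Submodule.Quotient.mk ⟨WithLp.toLp 2 fun i => (z i : V i),
      (hP _).2 fun i => (z i).2⟩, ?_⟩
    funext i
    rw [← hz i]
    rfl
  exact ⟨Module.Finite.of_injective φ hi,
    (LinearEquiv.ofBijective φ ⟨hi, hs⟩).finrank_eq.trans (Module.finrank_pi_fintype ℂ)⟩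

lemma commens_pi_iff (hP : ∀ x, x ∈ P ↔ ∀ i, x i ∈ p i) (hQ : ∀ x, x ∈ Q ↔ ∀ i, x i ∈ q i) :
    Commens P Q ↔ ∀ i, Commens (p i) (q i) := by
  constructor
  · rintro ⟨_, _⟩ i
    exact ⟨finiteDimensional_relQuot_of_pi hP hQ i, finiteDimensional_relQuot_of_pi hQ hP i⟩
  · intro h
    have := fun i => (h i).1
    have := fun i => (h i).2
    exact ⟨(finiteDimensional_relQuot_pi hP hQ).1, (finiteDimensional_relQuot_pi hQ hP).1⟩

lemma relDim_pi (hP : ∀ x, x ∈ P ↔ ∀ i, x i ∈ p i) (hQ : ∀ x, x ∈ Q ↔ ∀ i, x i ∈ q i)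
    (h : ∀ i, Commens (p i) (q i)) : relDim P Q = ∑ i, relDim (p i) (q i) := by
  have := fun i => (h i).1
  have := fun i => (h i).2
  simp only [relDim]
  rw [(finiteDimensional_relQuot_pi hP hQ).2, (finiteDimensional_relQuot_pi hQ hP).2,
    Finset.sum_sub_distrib]
  push_cast
  rfl

lemma isCompactOperator_pi {X : Type*} [NormedAddCommGroup X] [NormedSpace ℂ X]
    {A : ∀ i, X →L[ℂ] V i} (h : ∀ i, IsCompactOperator (A i)) :
    IsCompactOperator (ContinuousLinearMap.pi A) := by
  choose K hK hA using h
  refine ⟨Set.univ.pi K, isCompact_univ_pi hK,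
    Filter.mem_of_superset ((Filter.iInter_mem).2 hA) fun x hx i _ => ?_⟩
  exact Set.mem_iInter.1 hx i

end Pi

section Graded

variable (H : ℤ → Type*) [∀ p, NormedAddCommGroup (H p)] [∀ p, InnerProductSpace ℂ (H p)]

lemma fcastL_fcastL {p q r : ℤ} (h : p = q) (h' : q = r) (x : H p) :
    fcastL H h' (fcastL H h x) = fcastL H (h.trans h') x := by
  subst h h'; rfl

lemma fcastL_eq_zero {p q : ℤ} (h : p = q) (x : H p) : fcastL H h x = 0 ↔ x = 0 := by
  subst h; rfl

lemma map_fcastL_eq_zero (δ : ∀ p : ℤ, H p →L[ℂ] H (p - 1)) {p q : ℤ} (h : p = q) (x : H p) :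
    δ q (fcastL H h x) = 0 ↔ δ p x = 0 := by
  subst h; rfl

lemma mem_chainRange {δ : ∀ p : ℤ, H p →L[ℂ] H (p - 1)} {p : ℤ} {y : H p} :
    y ∈ chainRange H δ p ↔
      ∃ z, fcastL H (show p + 1 - 1 = p by ring) (δ (p + 1) z) = y := by
  simp [chainRange]

variable {ι κ : Type*} [Fintype ι] (f : ι → ℤ) (g : κ → ℤ)

open Classical in
/-- The component of degree `p` of an element of the direct sum of the `H (f i)`. -/
def component (p : ℤ) : PiLp 2 (fun i => H (f i)) →L[ℂ] H p :=
  if h : ∃ i, f i = p then fcastL H h.choose_spec ∘L PiLp.proj 2 (fun i => H (f i)) h.choose else 0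

variable {f g} in
lemma component_eq (hf : Function.Injective f) {p : ℤ} {i : ι} (h : f i = p)
    (x : PiLp 2 (fun i => H (f i))) : component H f p x = fcastL H h (x i) := by
  have h' : ∃ i, f i = p := ⟨i, h⟩
  have key : ∀ (j : ι) (hj : f j = p), fcastL H hj (x j) = fcastL H h (x i) := by
    intro j hj
    obtain rfl : j = i := hf (hj.trans h.symm)
    rfl
  rw [component, dif_pos h']
  exact key _ h'.choose_spec

/-- The components `H (g i + 1) → H (g i)` of a family of operators `δ p : H p → H (p - 1)`,
assembled into a single operator. -/
def assemble (δ : ∀ p : ℤ, H p →L[ℂ] H (p - 1)) :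
    PiLp 2 (fun i => H (f i)) →L[ℂ] PiLp 2 (fun i => H (g i)) :=
  (PiLp.continuousLinearEquiv 2 ℂ (fun i => H (g i))).symm.toContinuousLinearMap ∘L
    ContinuousLinearMap.pi fun i => fcastL H (show g i + 1 - 1 = g i by ring) ∘L
      δ (g i + 1) ∘L component H f (g i + 1)

lemma assemble_apply (δ : ∀ p : ℤ, H p →L[ℂ] H (p - 1)) (x : PiLp 2 (fun i => H (f i))) (i : κ) :
    assemble H f g δ x i = fcastL H (show g i + 1 - 1 = g i by ring)
      (δ (g i + 1) (component H f (g i + 1) x)) := rfl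

lemma assemble_add_sub [Fintype κ] (δ k : ∀ p : ℤ, H p →L[ℂ] H (p - 1)) :
    assemble H f g (fun p => δ p + k p) - assemble H f g δ = assemble H f g k := by
  ext x i
  change assemble H f g (fun p => δ p + k p) x i - assemble H f g δ x i = _
  simp [assemble_apply]

lemma isCompactOperator_assemble [Fintype κ] {k : ∀ p : ℤ, H p →L[ℂ] H (p - 1)}
    (hk : ∀ p, IsCompactOperator (k p)) : IsCompactOperator (assemble H f g k) :=
  (isCompactOperator_pi fun i => ((hk (g i + 1)).comp_clm
    (component H f (g i + 1))).clm_comp (fcastL H (show g i + 1 - 1 = g i by ring))).clm_comp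
      (PiLp.continuousLinearEquiv 2 ℂ (fun i => H (g i))).symm.toContinuousLinearMap

variable {f g}

lemma mem_ker_assemble (hf : Function.Injective f)
    (hgf : ∀ i, (∃ j, f j = g i + 1) ∨ Subsingleton (H (g i + 1)))
    (hfg : ∀ j, (∃ i, g i + 1 = f j) ∨ Subsingleton (H (f j - 1)))
    (δ : ∀ p : ℤ, H p →L[ℂ] H (p - 1)) (x : PiLp 2 (fun i => H (f i))) :
    x ∈ LinearMap.ker (assemble H f g δ).toLinearMap ↔
      ∀ j, x j ∈ LinearMap.ker (δ (f j)).toLinearMap := by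
  have h1 : x ∈ LinearMap.ker (assemble H f g δ).toLinearMap ↔
      ∀ i, δ (g i + 1) (component H f (g i + 1) x) = 0 := by
    rw [LinearMap.mem_ker]
    change assemble H f g δ x = 0 ↔ _
    rw [PiLp.ext_iff]
    simp only [assemble_apply, PiLp.zero_apply, fcastL_eq_zero]
  rw [h1]
  constructor
  · intro h j
    change δ (f j) (x j) = 0
    obtain ⟨i, hi⟩ | hj := hfg j
    · have := h i
      rwa [component_eq H hf hi.symm, map_fcastL_eq_zero] at this
    · exact Subsingleton.elim _ _
  · intro h i
    obtain ⟨j, hj⟩ | hi := hgf i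
    · rw [component_eq H hf hj, map_fcastL_eq_zero]
      exact h j
    · rw [Subsingleton.elim (component H f (g i + 1) x) 0, map_zero]

lemma mem_range_assemble [Fintype κ] (hf : Function.Injective f) (hg : Function.Injective g)
    (hgf : ∀ i, (∃ j, f j = g i + 1) ∨ Subsingleton (H (g i + 1)))
    (δ : ∀ p : ℤ, H p →L[ℂ] H (p - 1)) (y : PiLp 2 (fun i => H (g i))) :
    y ∈ LinearMap.range (assemble H f g δ).toLinearMap ↔ ∀ i, y i ∈ chainRange H δ (g i) := by
  constructor
  · rintro ⟨x, rfl⟩ i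
    exact (mem_chainRange H).2 ⟨_, rfl⟩
  · intro h
    choose z hz using fun i => (mem_chainRange H).1 (h i)
    have hg' : Function.Injective fun i => g i + 1 := fun a b hab => hg (add_right_cancel hab)
    refine ⟨WithLp.toLp 2 fun j => component H (fun i => g i + 1) (f j) (WithLp.toLp 2 z), ?_⟩
    change assemble H f g δ _ = y
    ext i
    rw [assemble_apply, ← hz i]
    congr 2
    obtain ⟨j, hj⟩ | hi := hgf i
    · rw [component_eq H hf hj]
      change fcastL H hj (component H (fun i => g i + 1) (f j) (WithLp.toLp 2 z)) = z i
      rw [component_eq H hg' (i := i) hj.symm, fcastL_fcastL]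
      rfl
    · exact Subsingleton.elim _ _

end Graded

section Chain

lemma commens_of_subsingleton {E : Type*} [AddCommGroup E] [Module ℂ E] [Subsingleton E]
    (p q : Submodule ℂ E) : Commens p q := by
  obtain rfl := Subsingleton.elim p q
  have := subsingleton_relQuot (le_refl p)
  exact ⟨inferInstance, inferInstance⟩

lemma relDim_of_subsingleton {E : Type*} [AddCommGroup E] [Module ℂ E] [Subsingleton E]
    (p q : Submodule ℂ E) : relDim p q = 0 := by
  obtain rfl := Subsingleton.elim p q
  exact sub_self _

lemma injective_even (n : ℕ) : Function.Injective fun i : Fin (n + 1) => 2 * (i : ℤ) := by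
  intro a b h
  have h : 2 * (a : ℤ) = 2 * (b : ℤ) := h
  ext
  omega

lemma injective_odd (n : ℕ) : Function.Injective fun i : Fin (n + 1) => 2 * (i : ℤ) + 1 := by
  intro a b h
  have h : 2 * (a : ℤ) + 1 = 2 * (b : ℤ) + 1 := h
  ext
  omega

lemma sum_range_two_mul_neg_one_pow (r : ℤ → ℤ) (m : ℕ) :
    ∑ j ∈ Finset.range (2 * m), (-1 : ℤ) ^ j * r j =
      ∑ i ∈ Finset.range m, (r (2 * (i : ℤ)) - r (2 * (i : ℤ) + 1)) := by
  induction m with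
  | zero => simp
  | succ m ih =>
    rw [Finset.sum_range_succ, ← ih, show 2 * (m + 1) = 2 * m + 1 + 1 by ring,
      Finset.sum_range_succ, Finset.sum_range_succ]
    simp only [pow_succ, pow_mul]
    push_cast
    ring

variable {H : ℤ → Type*}

lemma exists_odd_add_one_eq [∀ p, NormedAddCommGroup (H p)] {n : ℕ}
    (hzero : ∀ p : ℤ, (p < 0 ∨ (n : ℤ) + 1 ≤ p) → Subsingleton (H p)) (j : Fin (n + 1)) :
    (∃ i : Fin (n + 1), 2 * (i : ℤ) + 1 + 1 = 2 * (j : ℤ)) ∨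
      Subsingleton (H (2 * (j : ℤ) - 1)) := by
  by_cases h : (j : ℕ) = 0
  · exact Or.inr (hzero _ (by omega))
  · refine Or.inl ⟨⟨j - 1, by omega⟩, ?_⟩
    dsimp only
    omega

lemma exists_even_eq_odd_add_one [∀ p, NormedAddCommGroup (H p)] {n : ℕ}
    (hzero : ∀ p : ℤ, (p < 0 ∨ (n : ℤ) + 1 ≤ p) → Subsingleton (H p)) (i : Fin (n + 1)) :
    (∃ j : Fin (n + 1), 2 * (j : ℤ) = 2 * (i : ℤ) + 1 + 1) ∨
      Subsingleton (H (2 * (i : ℤ) + 1 + 1)) := by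
  by_cases h : (i : ℕ) = n
  · exact Or.inr (hzero _ (by omega))
  · refine Or.inl ⟨⟨i + 1, by omega⟩, ?_⟩
    push_cast
    ring

variable [∀ p, NormedAddCommGroup (H p)] [∀ p, InnerProductSpace ℂ (H p)]
  {δ : ∀ p : ℤ, H p →L[ℂ] H (p - 1)}

lemma isFredholmChain_iff : IsFredholmChain H δ ↔
    ∀ p, Commens (LinearMap.ker (δ p).toLinearMap) (chainRange H δ p) := Iff.rfl

lemma finiteDimensional_relQuot_chainRange {p : ℤ}
    (h : FiniteDimensional ℂ (LinearMap.range (chainComp H δ p).toLinearMap)) :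
    FiniteDimensional ℂ (relQuot (chainRange H δ p) (LinearMap.ker (δ p).toLinearMap)) := by
  have : FiniteDimensional ℂ (relQuot (LinearMap.range (chainComp H δ p).toLinearMap) ⊥) :=
    Module.Finite.of_surjective _ (Submodule.mkQ_surjective _)
  refine Module.Finite.of_injective
    (relQuotMap (p' := LinearMap.range (chainComp H δ p).toLinearMap) (q' := ⊥)
      (δ p).toLinearMap ?_ ?_) (relQuotMap_injective _ _ _ ?_)
  · intro y hy
    obtain ⟨z, rfl⟩ := (mem_chainRange H).1 hy
    exact ⟨z, rfl⟩
  · exact fun x _ hx => hx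
  · exact fun x _ hx => hx

variable (H δ) in
/-- The part of a chain going from even degrees `2 * i` to odd degrees `2 * i + 1`, `i ≤ n`. -/
def evenToOdd (n : ℕ) : PiLp 2 (fun i : Fin (n + 1) => H (2 * (i : ℤ))) →L[ℂ]
    PiLp 2 (fun i : Fin (n + 1) => H (2 * (i : ℤ) + 1)) :=
  assemble H (fun i : Fin (n + 1) => 2 * (i : ℤ)) (fun i : Fin (n + 1) => 2 * (i : ℤ) + 1) δ

variable (H δ) in
/-- The part of a chain going from odd degrees `2 * i + 1` to even degrees `2 * i`, `i ≤ n`. -/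
def oddToEven (n : ℕ) : PiLp 2 (fun i : Fin (n + 1) => H (2 * (i : ℤ) + 1)) →L[ℂ]
    PiLp 2 (fun i : Fin (n + 1) => H (2 * (i : ℤ))) :=
  assemble H (fun i : Fin (n + 1) => 2 * (i : ℤ) + 1) (fun i : Fin (n + 1) => 2 * (i : ℤ)) δ

variable {n : ℕ}

lemma mem_ker_oddToEven (x : PiLp 2 (fun i : Fin (n + 1) => H (2 * (i : ℤ) + 1))) :
    x ∈ LinearMap.ker (oddToEven H δ n).toLinearMap ↔
      ∀ j : Fin (n + 1), x j ∈ LinearMap.ker (δ (2 * (j : ℤ) + 1)).toLinearMap :=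
  mem_ker_assemble H (injective_odd n) (fun i => Or.inl ⟨i, rfl⟩) (fun j => Or.inl ⟨j, rfl⟩) δ x

lemma mem_range_oddToEven (y : PiLp 2 (fun i : Fin (n + 1) => H (2 * (i : ℤ)))) :
    y ∈ LinearMap.range (oddToEven H δ n).toLinearMap ↔
      ∀ i : Fin (n + 1), y i ∈ chainRange H δ (2 * (i : ℤ)) :=
  mem_range_assemble H (injective_odd n) (injective_even n) (fun i => Or.inl ⟨i, rfl⟩) δ y

lemma mem_ker_evenToOdd
    (hzero : ∀ p : ℤ, (p < 0 ∨ (n : ℤ) + 1 ≤ p) → Subsingleton (H p))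
    (x : PiLp 2 (fun i : Fin (n + 1) => H (2 * (i : ℤ)))) :
    x ∈ LinearMap.ker (evenToOdd H δ n).toLinearMap ↔
      ∀ j : Fin (n + 1), x j ∈ LinearMap.ker (δ (2 * (j : ℤ))).toLinearMap :=
  mem_ker_assemble H (injective_even n) (exists_even_eq_odd_add_one hzero)
    (exists_odd_add_one_eq hzero) δ x

lemma mem_range_evenToOdd
    (hzero : ∀ p : ℤ, (p < 0 ∨ (n : ℤ) + 1 ≤ p) → Subsingleton (H p))
    (y : PiLp 2 (fun i : Fin (n + 1) => H (2 * (i : ℤ) + 1))) :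
    y ∈ LinearMap.range (evenToOdd H δ n).toLinearMap ↔
      ∀ i : Fin (n + 1), y i ∈ chainRange H δ (2 * (i : ℤ) + 1) :=
  mem_range_assemble H (injective_even n) (injective_odd n) (exists_even_eq_odd_add_one hzero) δ y

lemma isFredholmChain_iff_isFredholmPair
    (hzero : ∀ p : ℤ, (p < 0 ∨ (n : ℤ) + 1 ≤ p) → Subsingleton (H p)) :
    IsFredholmChain H δ ↔ IsFredholmPair (evenToOdd H δ n) (oddToEven H δ n) := by
  rw [isFredholmPair_iff, isFredholmChain_iff,
    commens_pi_iff (mem_ker_evenToOdd hzero) mem_range_oddToEven,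
    commens_pi_iff mem_ker_oddToEven (mem_range_evenToOdd hzero)]
  refine ⟨fun h => ⟨fun i => h _, fun i => h _⟩, fun ⟨h1, h2⟩ p => ?_⟩
  by_cases hp : p < 0 ∨ (n : ℤ) + 1 ≤ p
  · have := hzero p hp
    exact commens_of_subsingleton _ _
  · obtain ⟨m, hm | hm⟩ := Int.even_or_odd' p
    · have := h1 ⟨m.toNat, by omega⟩
      rwa [show 2 * (((⟨m.toNat, by omega⟩ : Fin (n + 1)) : ℕ) : ℤ) = p by
        dsimp only; omega] at this
    · have := h2 ⟨m.toNat, by omega⟩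
      rwa [show 2 * (((⟨m.toNat, by omega⟩ : Fin (n + 1)) : ℕ) : ℤ) + 1 = p by
        dsimp only; omega] at this

lemma chainIndex_eq_pairIndex
    (hzero : ∀ p : ℤ, (p < 0 ∨ (n : ℤ) + 1 ≤ p) → Subsingleton (H p))
    (h : IsFredholmChain H δ) :
    chainIndex H δ n = pairIndex (evenToOdd H δ n) (oddToEven H δ n) := by
  rw [pairIndex_eq, relDim_pi (mem_ker_evenToOdd hzero) mem_range_oddToEven fun i => h _,
    relDim_pi mem_ker_oddToEven (mem_range_evenToOdd hzero) fun i => h _, ← Finset.sum_sub_distrib]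
  set r : ℤ → ℤ := fun p => relDim (LinearMap.ker (δ p).toLinearMap) (chainRange H δ p) with hr
  change ∑ j ∈ Finset.range (n + 1), (-1 : ℤ) ^ j * r j =
    ∑ i : Fin (n + 1), (r (2 * (i : ℤ)) - r (2 * (i : ℤ) + 1))
  rw [← Finset.sum_range fun i : ℕ => r (2 * (i : ℤ)) - r (2 * (i : ℤ) + 1),
    ← sum_range_two_mul_neg_one_pow]
  refine Finset.sum_subset (Finset.range_subset_range.2 (by omega)) fun j _ hj => ?_
  rw [Finset.mem_range] at hj
  have := hzero j (by omega)
  rw [hr]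
  dsimp only
  rw [relDim_of_subsingleton, mul_zero]

end Chain

theorem fredholm_chain_compact_stability (H : ℤ → Type) [∀ p, NormedAddCommGroup (H p)]
    [∀ p, InnerProductSpace ℂ (H p)] [∀ p, CompleteSpace (H p)] (n : ℕ)
    (hzero : ∀ p : ℤ, (p < 0 ∨ (n : ℤ) + 1 ≤ p) → Subsingleton (H p))
    (δ : ∀ p : ℤ, H p →L[ℂ] H (p - 1))
    (hfred : IsFredholmChain H δ)
    (k : ∀ p : ℤ, H p →L[ℂ] H (p - 1)) (hk : ∀ p : ℤ, IsCompactOperator (⇑(k p)))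
    (hcomp : ∀ p : ℤ, FiniteDimensional ℂ
      (LinearMap.range (chainComp H (fun p => δ p + k p) p).toLinearMap)) :
    IsFredholmChain H (fun p => δ p + k p) ∧
      chainIndex H δ n = chainIndex H (fun p => δ p + k p) n := by
  have hrange := fun p => finiteDimensional_relQuot_chainRange (hcomp p)
  have h0 := (isFredholmChain_iff_isFredholmPair hzero).1 hfred
  have hS : IsFiniteRankLimit (evenToOdd H (fun p => δ p + k p) n - evenToOdd H δ n) := by
    refine isFiniteRankLimit_of_isCompactOperator ?_
    rw [evenToOdd, evenToOdd, assemble_add_sub]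
    exact isCompactOperator_assemble H _ _ hk
  have hT : IsFiniteRankLimit (oddToEven H (fun p => δ p + k p) n - oddToEven H δ n) := by
    refine isFiniteRankLimit_of_isCompactOperator ?_
    rw [oddToEven, oddToEven, assemble_add_sub]
    exact isCompactOperator_assemble H _ _ hk
  have hTS := (finiteDimensional_relQuot_pi (mem_range_oddToEven (n := n) (δ := fun p => δ p + k p))
    (mem_ker_evenToOdd hzero (δ := fun p => δ p + k p))).1
  have hST := (finiteDimensional_relQuot_pi
    (mem_range_evenToOdd hzero (δ := fun p => δ p + k p))
    (mem_ker_oddToEven (δ := fun p => δ p + k p))).1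
  obtain ⟨h1, h2⟩ := h0.stability hS hT
  have h := (isFredholmChain_iff_isFredholmPair hzero).2 h1
  exact ⟨h, by rw [chainIndex_eq_pairIndex hzero hfred, chainIndex_eq_pairIndex hzero h, h2]⟩
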